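/- Let A be a C*-algebra and let I be a closed two-sided ideal of A. Suppose that for every positive element a ∈ A with a ∉ I, the element σ(a) is norm-full in the multiplier algebra M(I), i.e., the smallest closed two-sided ideal of M(I) containing σ(a) is M(I) itself. Then the extension 0 → I → A → A/I → 0 is stenotic: every closed two-sided ideal D of A satisfies D ⊆ I or I ⊆ D. -/

import Mathlib

open MultiplierAlgebra

/-- An element of a C*-algebra is positive if it is of the form `x* x`. -/
def IsPositiveElem {A : Type*} [NonUnitalCStarAlgebra A] (a : A) : Prop :=
  ∃ x : A, a = star x * x

/-- The smallest closed two-sided ideal of `C` containing a given subset `s`, realized as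
the intersection of all closed two-sided ideals containing `s`. -/
def closedIdealGeneratedBy {C : Type*} [NonUnitalNonAssocRing C] [TopologicalSpace C]
    (s : Set C) : Set C :=
  ⋂ J ∈ {J : TwoSidedIdeal C | IsClosed (J : Set C) ∧ s ⊆ (J : Set C)}, (J : Set C)

/-- The canonical homomorphism `σ : A → M(I)` for a closed two-sided ideal `I` of a
C*-algebra `A`, sending `a : A` to the multiplier `(x ↦ a x, x ↦ x a)` of `I`. -/
noncomputable def idealMultiplier {A : Type*} [NonUnitalCStarAlgebra A]
    (S : NonUnitalStarSubalgebra ℂ A) [IsClosed (S : Set A)]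
    (hS : ∀ a : A, ∀ x ∈ S, a * x ∈ S ∧ x * a ∈ S) (a : A) : 𝓜(ℂ, S) where
  fst := LinearMap.mkContinuous
    { toFun := fun x : S => (⟨a * (x : A), (hS a x x.2).1⟩ : S)
      map_add' := fun x y => Subtype.ext (by simp [mul_add])
      map_smul' := fun c x => Subtype.ext (by simp [mul_smul_comm]) } ‖a‖
    (fun x => by simpa using norm_mul_le a (x : A))
  snd := LinearMap.mkContinuous
    { toFun := fun x : S => (⟨(x : A) * a, (hS a x x.2).2⟩ : S)
      map_add' := fun x y => Subtype.ext (by simp [add_mul])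
      map_smul' := fun c x => Subtype.ext (by simp [smul_mul_assoc]) } ‖a‖
    (fun x => by simpa [mul_comm] using norm_mul_le (x : A) a)
  central := fun x y => Subtype.ext (by simpa using mul_assoc (x : A) a (y : A))

open Filter Topology

/-- A C*-algebra has an approximate unit in its closed unit ball. -/
theorem exists_isApproximateUnit_norm_le_one (B : Type*) [NonUnitalCStarAlgebra B] :
    ∃ l : Filter B, l.IsApproximateUnit ∧ ∀ᶠ e in l, ‖e‖ ≤ 1 := by
  let _ := CStarAlgebra.spectralOrder B
  let _ := CStarAlgebra.spectralOrderedRing B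
  have h := CStarAlgebra.increasingApproximateUnit B
  exact ⟨_, h.toIsApproximateUnit, h.eventually_norm⟩

/-- If `star d * d` is the limit of `star d * d * e` along a bounded filter, then `d` is the limit
of `d * e`. -/
theorem tendsto_mul_of_tendsto_star_mul_self_mul {A ι : Type*} [NonUnitalCStarAlgebra A]
    {l : Filter ι} {e : ι → A} (he : ∀ᶠ i in l, ‖e i‖ ≤ 1) {d : A}
    (h : Tendsto (fun i => star d * d * e i) l (𝓝 (star d * d))) :
    Tendsto (fun i => d * e i) l (𝓝 d) := by
  have h₀ : Tendsto (fun i => star d * d * e i - star d * d) l (𝓝 0) :=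
    tendsto_sub_nhds_zero_iff.2 h
  have h₁ : Tendsto (fun i => 2 * ‖star d * d * e i - star d * d‖) l (𝓝 0) := by
    simpa using h₀.norm.const_mul 2
  have h₂ : Tendsto (fun i => ‖d * e i - d‖ * ‖d * e i - d‖) l (𝓝 0) := by
    refine squeeze_zero' (.of_forall fun i => by positivity) ?_ h₁
    filter_upwards [he] with i hi
    set c := star d * d * e i - star d * d with hc
    have key : star (d * e i - d) * (d * e i - d) = star (e i) * c - c := by
      simp only [hc, star_sub, star_mul]
      noncomm_ring
    calc ‖d * e i - d‖ * ‖d * e i - d‖ = ‖star (e i) * c - c‖ := by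
          rw [← CStarRing.norm_star_mul_self, key]
      _ ≤ ‖star (e i)‖ * ‖c‖ + ‖c‖ :=
          (norm_sub_le _ _).trans (add_le_add_left (norm_mul_le _ _) _)
      _ ≤ 2 * ‖c‖ := by
          rw [norm_star]
          nlinarith [norm_nonneg c]
  rw [← tendsto_sub_nhds_zero_iff, tendsto_zero_iff_norm_tendsto_zero]
  simpa using h₂.sqrt

/-- A closed ideal containing `star d * d` contains `d`. -/
theorem mem_of_star_mul_self_mem {A : Type*} [NonUnitalCStarAlgebra A]
    (S : NonUnitalStarSubalgebra ℂ A) [hSc : IsClosed (S : Set A)]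
    (hS : ∀ a : A, ∀ x ∈ S, a * x ∈ S) {d : A} (hd : star d * d ∈ S) : d ∈ S := by
  obtain ⟨l, hl, hl₁⟩ := exists_isApproximateUnit_norm_le_one S
  have := hl.neBot
  have h : Tendsto (fun e : S => d * (e : A)) l (𝓝 d) :=
    tendsto_mul_of_tendsto_star_mul_self_mul (e := fun e : S => (e : A)) hl₁
      ((continuous_subtype_val.tendsto _).comp (hl.tendsto_mul_left ⟨_, hd⟩))
  exact hSc.mem_of_tendsto h (.of_forall fun e => hS d e e.2)

/-- The multipliers `m` of `S` such that `x * m y ∈ D` for all `x y : S`. -/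
noncomputable def multiplierIdeal {A : Type*} [NonUnitalCStarAlgebra A]
    (S : NonUnitalStarSubalgebra ℂ A) [IsClosed (S : Set A)] (D : TwoSidedIdeal A) :
    TwoSidedIdeal 𝓜(ℂ, S) :=
  TwoSidedIdeal.mk' {m | ∀ x y : S, (x : A) * (m.fst y : A) ∈ D}
    (fun x y => by simp)
    (fun {m n} hm hn x y => by simpa [mul_add] using D.add_mem (hm x y) (hn x y))
    (fun {m} hm x y => by simpa using D.neg_mem (hm x y))
    (fun {n m} hm x y => by
      have h : (x : A) * (n.fst (m.fst y) : A) = (n.snd x : A) * (m.fst y : A) :=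
        congrArg Subtype.val (n.central x (m.fst y)).symm
      simpa [h] using hm (n.snd x) y)
    (fun {m n} hm x y => by simpa using hm x (n.fst y))

theorem mem_multiplierIdeal {A : Type*} [NonUnitalCStarAlgebra A]
    {S : NonUnitalStarSubalgebra ℂ A} [IsClosed (S : Set A)] {D : TwoSidedIdeal A}
    {m : 𝓜(ℂ, S)} :
    m ∈ multiplierIdeal S D ↔ ∀ x y : S, (x : A) * (m.fst y : A) ∈ D := by
  simp [multiplierIdeal]

theorem isClosed_multiplierIdeal {A : Type*} [NonUnitalCStarAlgebra A]
    (S : NonUnitalStarSubalgebra ℂ A) [IsClosed (S : Set A)] {D : TwoSidedIdeal A}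
    (hD : IsClosed (D : Set A)) : IsClosed (multiplierIdeal S D : Set 𝓜(ℂ, S)) := by
  have hfst : Continuous fun m : 𝓜(ℂ, S) => m.fst := by
    refine AddMonoidHomClass.continuous_of_bound
      (AddMonoidHom.mk' (fun m : 𝓜(ℂ, S) => m.fst) DoubleCentralizer.add_fst) 1 fun m => ?_
    simp [DoubleCentralizer.norm_fst]
  have h : (multiplierIdeal S D : Set 𝓜(ℂ, S)) =
      ⋂ (x : S) (y : S), (fun m : 𝓜(ℂ, S) => (x : A) * (m.fst y : A)) ⁻¹' (D : Set A) := by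
    ext m
    simp [mem_multiplierIdeal]
  rw [h]
  exact isClosed_iInter fun x => isClosed_iInter fun y => hD.preimage <|
    continuous_const.mul (continuous_subtype_val.comp (hfst.clm_apply continuous_const))

/-- Let `A` be a C*-algebra and `I` a closed two-sided ideal of `A`.  Suppose
that for every positive element `a ∈ A` with `a ∉ I`, the element `σ(a)` is norm-full in
the multiplier algebra `M(I)`.  Then the extension `0 → I → A → A/I → 0` is stenotic:
every closed two-sided ideal `D` of `A` satisfies `D ⊆ I` or `I ⊆ D`. -/
theorem stenotic_of_multiplier_full
    {A : Type*} [NonUnitalCStarAlgebra A]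
    (S : NonUnitalStarSubalgebra ℂ A) [IsClosed (S : Set A)]
    (hS : ∀ a : A, ∀ x ∈ S, a * x ∈ S ∧ x * a ∈ S)
    (hfull : ∀ a : A, IsPositiveElem a → a ∉ S →
      closedIdealGeneratedBy {idealMultiplier S hS a} = Set.univ) :
    ∀ D : TwoSidedIdeal A, IsClosed (D : Set A) →
      (D : Set A) ⊆ (S : Set A) ∨ (S : Set A) ⊆ (D : Set A) := by
  intro D hD
  refine or_iff_not_imp_left.2 fun hDS => ?_
  obtain ⟨d, hdD, hdS⟩ := Set.not_subset.1 hDS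
  have hmem : star d * d ∉ S := fun h =>
    hdS (mem_of_star_mul_self_mem S (fun a x hx => (hS a x hx).1) h)
  have hσ : idealMultiplier S hS (star d * d) ∈ multiplierIdeal S D :=
    mem_multiplierIdeal.2 fun x y =>
      D.mul_mem_left _ _ (D.mul_mem_right _ _ (D.mul_mem_left _ _ hdD))
  have h₁ : (1 : 𝓜(ℂ, S)) ∈ closedIdealGeneratedBy {idealMultiplier S hS (star d * d)} := by
    rw [hfull _ ⟨d, rfl⟩ hmem]
    trivial
  have h₂ : (1 : 𝓜(ℂ, S)) ∈ multiplierIdeal S D :=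
    Set.mem_iInter₂.1 h₁ _ ⟨isClosed_multiplierIdeal S hD, Set.singleton_subset_iff.2 hσ⟩
  intro x hx
  obtain ⟨l, hl, -⟩ := exists_isApproximateUnit_norm_le_one S
  have := hl.neBot
  have hlim : Tendsto (fun e : S => x * (e : A)) l (𝓝 x) :=
    (continuous_subtype_val.tendsto _).comp (hl.tendsto_mul_left ⟨x, hx⟩)
  exact hD.mem_of_tendsto hlim (.of_forall fun e => mem_multiplierIdeal.1 h₂ ⟨x, hx⟩ e)
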